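/- arXiv:1505.00552 — 3 statements merged into one kernel-verified Lean document; each statement's English description precedes it below -/
import Mathlib

section
/- Let n ≥ 1, k = 3, r = 2^n − 1, and d = (2^{n+1} − 1)(2^n − 1)/3. Let A be the naive matrix of type (k,r), i.e., the unique matrix over {0,1} with rows and columns indexed by positive integers such that A(i,j) = 1 iff none of the following holds: (i) there exist i' < i, j' < j with A(i,j') = A(i',j) = A(i',j') = 1; (ii) Σ_{j'<j} A(i,j') ≥ k; (iii) Σ_{i'<i} A(i',j) ≥ r. Then for every i with 1 ≤ i ≤ d, the support L_i = {j : A(i,j) = 1} of the i-th row is of the form {a, b, a ⊕ b} for some positive integers a, b with 0 < a < b < a ⊕ b < 2^{n+1}, where ⊕ is Nim addition (bitwise XOR). -/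
/-- `A` is the *naive matrix* of type `(k, r)`: a `{0,1}`-matrix (here `Bool`-valued)
indexed by the positive integers, where `A i j = true` iff none of the following holds:
(i) there are `i' < i`, `j' < j` with `A i j' = A i' j = A i' j' = true`;
(ii) the `i`-th row already contains `k` ones before column `j`;
(iii) the `j`-th column already contains `r` ones before row `i`. -/
def IsNaiveMatrix (k r : ℕ) (A : ℕ+ → ℕ+ → Bool) : Prop :=
  ∀ i j : ℕ+,
    A i j = true ↔
      ¬ ((∃ i' < i, ∃ j' < j, A i j' = true ∧ A i' j = true ∧ A i' j' = true) ∨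
         k ≤ ((Finset.Ico 1 j).filter fun j' => A i j' = true).card ∨
         r ≤ ((Finset.Ico 1 i).filter fun i' => A i' j = true).card)

open Classical in
/-- Natural-number version of the naive matrix specification (index `0` is empty). -/
def NatSpec (r : ℕ) (B : ℕ → ℕ → Prop) : Prop :=
  (∀ i j, B i j → 0 < i ∧ 0 < j) ∧
  ∀ i j, 0 < i → 0 < j →
    (B i j ↔ ¬ ((∃ i' < i, ∃ j' < j, B i j' ∧ B i' j ∧ B i' j') ∨
      3 ≤ ((Finset.range j).filter fun j' => B i j').card ∨
      r ≤ ((Finset.range i).filter fun i' => B i' j).card))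

/-- Row `i` is a line. -/
def LineRow (N : ℕ) (B : ℕ → ℕ → Prop) (i : ℕ) : Prop :=
  ∃ a b : ℕ, 0 < a ∧ a < b ∧ b < a ^^^ b ∧ a ^^^ b < N ∧
    ∀ j : ℕ, B i j ↔ (j = a ∨ j = b ∨ j = a ^^^ b)

lemma LineRow.lt {N i : ℕ} {B : ℕ → ℕ → Prop} (h : LineRow N B i) {x : ℕ} (hx : B i x) :
    0 < x ∧ x < N := by
  obtain ⟨a, b, h1, h2, h3, h4, h5⟩ := h
  rcases (h5 x).1 hx with rfl | rfl | rfl <;> omega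

lemma LineRow.xor_mem {N i : ℕ} {B : ℕ → ℕ → Prop} (h : LineRow N B i) {x y : ℕ} (hx : B i x)
    (hy : B i y) (hxy : x ≠ y) : B i (x ^^^ y) := by
  obtain ⟨a, b, h1, h2, h3, h4, h5⟩ := h
  rw [h5] at *
  have e1 : a ^^^ (a ^^^ b) = b := by simp
  have e2 : b ^^^ (a ^^^ b) = a := by rw [Nat.xor_comm a b]; simp
  rcases hx with rfl | rfl | rfl <;> rcases hy with rfl | rfl | rfl <;>
    simp_all [Nat.xor_comm]

open Classical in
lemma LineRow.card3 {N i : ℕ} {B : ℕ → ℕ → Prop} (h : LineRow N B i) :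
    ((Finset.range N).filter fun y => B i y).card = 3 := by
  obtain ⟨a, b, h1, h2, h3, h4, h5⟩ := h
  have : ((Finset.range N).filter fun y => B i y) = {a, b, a ^^^ b} := by
    ext y
    simp only [Finset.mem_filter, Finset.mem_range, h5, Finset.mem_insert, Finset.mem_singleton]
    constructor
    · exact fun h => h.2
    · intro h
      refine ⟨?_, h⟩
      omega
  rw [this, Finset.card_eq_three]
  exact ⟨a, b, a ^^^ b, by omega, by omega, by omega, rfl⟩

open Classical in
lemma LineRow.card2 {N i : ℕ} {B : ℕ → ℕ → Prop} (h : LineRow N B i) {x : ℕ} (hx : B i x) :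
    ((Finset.range N).filter fun y => y ≠ x ∧ B i y).card = 2 := by
  have e : ((Finset.range N).filter fun y => y ≠ x ∧ B i y)
      = ((Finset.range N).filter fun y => B i y).erase x := by
    ext y
    simp only [Finset.mem_filter, Finset.mem_range, Finset.mem_erase]
    tauto
  rw [e, Finset.card_erase_of_mem, h.card3]
  simp [hx, (h.lt hx).2]

lemma NatSpec.uniq {r : ℕ} {B : ℕ → ℕ → Prop} (h : NatSpec r B) {p q x y : ℕ}
    (hpx : B p x) (hpy : B p y) (hqx : B q x) (hqy : B q y) (hxy : x ≠ y) : p = q := by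
  have key : ∀ {p q x y : ℕ}, B p x → B p y → B q x → B q y → x < y → ¬ p < q := by
    intro p q x y hpx hpy hqx hqy hxy hpq
    have h0 := h.1 _ _ hqy
    exact (h.2 q y h0.1 h0.2).1 hqy (Or.inl ⟨p, hpq, x, hxy, hqx, hpy, hpx⟩)
  rcases lt_or_gt_of_ne hxy with hl | hl
  · have h1 := key hpx hpy hqx hqy hl
    have h2 := key hqx hqy hpx hpy hl
    omega
  · have h1 := key hpy hpx hqy hqx hl
    have h2 := key hqy hqx hpy hpx hl
    omega

open Classical in
lemma NatSpec.col {r N : ℕ} {B : ℕ → ℕ → Prop} (h : NatSpec r B) (i : ℕ)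
    (H : ∀ p < i, 0 < p → LineRow N B p) (x : ℕ) :
    ((Finset.range N).filter fun y => y ≠ x ∧ ∃ p < i, B p x ∧ B p y).card
      = 2 * ((Finset.range i).filter fun p => B p x).card := by
  have e : ((Finset.range N).filter fun y => y ≠ x ∧ ∃ p < i, B p x ∧ B p y)
      = ((Finset.range i).filter fun p => B p x).biUnion
        (fun p => (Finset.range N).filter fun y => y ≠ x ∧ B p y) := by
    ext y
    simp only [Finset.mem_filter, Finset.mem_range, Finset.mem_biUnion]
    constructor
    · rintro ⟨h1, h2, p, h3, h4, h5⟩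
      exact ⟨p, ⟨h3, h4⟩, h1, h2, h5⟩
    · rintro ⟨p, ⟨h3, h4⟩, h1, h2, h5⟩
      exact ⟨h1, h2, p, h3, h4, h5⟩
  rw [e, Finset.card_biUnion, Finset.sum_const_nat (m := 2), mul_comm]
  · intro p hp
    simp only [Finset.mem_filter, Finset.mem_range] at hp
    exact (H p hp.1 (h.1 _ _ hp.2).1).card2 hp.2
  · intro p hp q hq hpq
    simp only [Finset.coe_filter, Finset.mem_range, Set.mem_ofPred_eq] at hp hq
    rw [Function.onFun, Finset.disjoint_left]
    intro y hy hy'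
    simp only [Finset.mem_filter, Finset.mem_range] at hy hy'
    exact hpq (h.uniq hp.2 hy.2.2 hq.2 hy'.2.2 hy.2.1.symm)

lemma card_punctured {N x : ℕ} (h0 : 0 < x) (hx : x < N) :
    ((Finset.range N).filter fun y => y ≠ x ∧ 0 < y).card = N - 2 := by
  have e : ((Finset.range N).filter fun y => y ≠ x ∧ 0 < y)
      = ((Finset.range N).erase x).erase 0 := by
    ext y
    simp only [Finset.mem_filter, Finset.mem_range, Finset.mem_erase]
    omega
  rw [e, Finset.card_erase_of_mem, Finset.card_erase_of_mem, Finset.card_range]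
  · omega
  · simpa using hx
  · simp; omega

open Classical in
lemma NatSpec.full {r N : ℕ} {B : ℕ → ℕ → Prop} (h : NatSpec r B) (hN : N = 2 * r + 2) (i : ℕ)
    (H : ∀ p < i, 0 < p → LineRow N B p) (x : ℕ) (h0 : 0 < x) (hx : x < N)
    (hu : ∀ y, 0 < y → y < N → y ≠ x → ∃ p < i, B p x ∧ B p y) :
    r ≤ ((Finset.range i).filter fun p => B p x).card := by
  have h1 := h.col i H x
  have h2 := card_punctured h0 hx
  have h3 : ((Finset.range N).filter fun y => y ≠ x ∧ 0 < y) ⊆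
     ((Finset.range N).filter fun y => y ≠ x ∧ ∃ p < i, B p x ∧ B p y) := by
    intro y hy
    simp only [Finset.mem_filter, Finset.mem_range] at hy ⊢
    exact ⟨hy.1, hy.2.1, hu y hy.2.2 hy.1 hy.2.1⟩
  have h4 := Finset.card_le_card h3
  omega

open Classical in
lemma NatSpec.notfull {r N : ℕ} {B : ℕ → ℕ → Prop} (h : NatSpec r B) (hN : N = 2 * r + 2) (i : ℕ)
    (H : ∀ p < i, 0 < p → LineRow N B p) (x : ℕ) (h0 : 0 < x) (hx : x < N)
    (y : ℕ) (hy0 : 0 < y) (hy : y < N) (hyx : y ≠ x) (hu : ¬ ∃ p < i, B p x ∧ B p y) :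
    ¬ r ≤ ((Finset.range i).filter fun p => B p x).card := by
  have h1 := h.col i H x
  have h2 := card_punctured h0 hx
  have h3 : ((Finset.range N).filter fun y => y ≠ x ∧ ∃ p < i, B p x ∧ B p y) ⊂
     ((Finset.range N).filter fun y => y ≠ x ∧ 0 < y) := by
    rw [Finset.ssubset_iff_of_subset]
    · refine ⟨y, ?_, ?_⟩
      · simp [hy, hyx, hy0]
      · simp only [Finset.mem_filter, Finset.mem_range]
        exact fun hh => hu hh.2.2
    · intro z hz
      simp only [Finset.mem_filter, Finset.mem_range] at hz ⊢
      obtain ⟨hz1, hz2, p, _, _, hp⟩ := hz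
      exact ⟨hz1, hz2, (h.1 _ _ hp).2⟩
  have h4 := Finset.card_lt_card h3
  omega

open Classical in
lemma NatSpec.exists_unused {r N : ℕ} {B : ℕ → ℕ → Prop} (h : NatSpec r B) (hN : N = 2 * r + 2)
    (i : ℕ) (hi0 : 0 < i) (hi : 3 * i ≤ (N - 1) * r)
    (H : ∀ p < i, 0 < p → LineRow N B p) :
    ∃ x, ∃ y, 0 < x ∧ x < N ∧ 0 < y ∧ y < N ∧ y ≠ x ∧ ¬ ∃ p < i, B p x ∧ B p y := by
  by_contra hcon
  have hall : ∀ x ∈ Finset.Ico 1 N, r ≤ ((Finset.range i).filter fun p => B p x).card := by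
    intro x hx
    simp only [Finset.mem_Ico] at hx
    apply h.full hN i H x hx.1 hx.2
    intro y h1 h2 h3
    by_contra h4
    exact hcon ⟨x, y, hx.1, hx.2, h1, h2, h3, h4⟩
  have h1 := Finset.card_nsmul_le_sum _ _ _ hall
  have h2 : ∑ x ∈ Finset.Ico 1 N, ((Finset.range i).filter fun p => B p x).card
      ≤ ∑ x ∈ Finset.range N, ((Finset.Ico 1 i).filter fun p => B p x).card := by
    have e : ∀ x, ((Finset.range i).filter fun p => B p x)
        = ((Finset.Ico 1 i).filter fun p => B p x) := by
      intro x
      ext p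
      simp only [Finset.mem_filter, Finset.mem_range, Finset.mem_Ico]
      constructor
      · rintro ⟨h1, h2⟩
        exact ⟨⟨(h.1 _ _ h2).1, h1⟩, h2⟩
      · rintro ⟨⟨_, h1⟩, h2⟩
        exact ⟨h1, h2⟩
    simp only [e]
    apply Finset.sum_le_sum_of_subset
    intro x hx
    simp only [Finset.mem_Ico, Finset.mem_range] at *
    omega
  have h3 := Finset.sum_card_bipartiteAbove_eq_sum_card_bipartiteBelow
    (s := Finset.Ico 1 i) (t := Finset.range N) B
  simp only [Finset.bipartiteAbove, Finset.bipartiteBelow] at h3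
  have h5 : ∑ p ∈ Finset.Ico 1 i, ((Finset.range N).filter fun y => B p y).card
      = (Finset.Ico 1 i).card * 3 := by
    apply Finset.sum_const_nat
    intro p hp
    simp only [Finset.mem_Ico] at hp
    exact (H p hp.2 hp.1).card3
  rw [← h3, h5] at h2
  simp only [Nat.card_Ico, smul_eq_mul] at h1 h2
  omega

lemma NatSpec.step {r N : ℕ} {B : ℕ → ℕ → Prop} (h : NatSpec r B) (hN : N = 2 * r + 2)
    (hpow : ∀ x y, x < N → y < N → x ^^^ y < N)
    (i : ℕ) (hi0 : 0 < i) (hi : 3 * i ≤ (N - 1) * r)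
    (H : ∀ p < i, 0 < p → LineRow N B p) : LineRow N B i := by
  classical
  have hex := h.exists_unused hN i hi0 hi H
  obtain ⟨U, hU⟩ : ∃ U : ℕ → ℕ → Prop, ∀ x y, U x y ↔ ∃ p < i, B p x ∧ B p y :=
    ⟨fun x y => ∃ p < i, B p x ∧ B p y, fun _ _ => Iff.rfl⟩
  simp only [← hU] at hex
  have Usymm : ∀ {x y}, U x y → U y x := by
    intro x y hxy
    rw [hU] at *
    obtain ⟨p, h1, h2, h3⟩ := hxy
    exact ⟨p, h1, h3, h2⟩
  have Uxor : ∀ {x y}, U x y → x ≠ y → U x (x ^^^ y) := by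
    intro x y hxy hne
    rw [hU] at *
    obtain ⟨p, h1, h2, h3⟩ := hxy
    exact ⟨p, h1, h2, (H p h1 (h.1 _ _ h2).1).xor_mem h2 h3 hne⟩
  obtain ⟨a, ha, hamin⟩ : ∃ a, (∃ y, 0 < a ∧ a < N ∧ 0 < y ∧ y < N ∧ y ≠ a ∧ ¬ U a y) ∧
      ∀ x < a, ¬ (∃ y, 0 < x ∧ x < N ∧ 0 < y ∧ y < N ∧ y ≠ x ∧ ¬ U x y) :=
    ⟨Nat.find hex, Nat.find_spec hex, fun x hx => Nat.find_min hex hx⟩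
  obtain ⟨b, ⟨ha0, haN, hb0, hbN, hba, hUab⟩, hbmin⟩ :
      ∃ b, (0 < a ∧ a < N ∧ 0 < b ∧ b < N ∧ b ≠ a ∧ ¬ U a b) ∧
      ∀ x < b, ¬ (0 < a ∧ a < N ∧ 0 < x ∧ x < N ∧ x ≠ a ∧ ¬ U a x) :=
    ⟨Nat.find ha, Nat.find_spec ha, fun x hx => Nat.find_min ha hx⟩
  have hamin' : ∀ x y, 0 < x → x < a → 0 < y → y < N → y ≠ x → U x y := by
    intro x y h1 h2 h3 h4 h5
    by_contra h6
    exact hamin x h2 ⟨y, h1, by omega, h3, h4, h5, h6⟩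
  have hbmin' : ∀ y, 0 < y → y < b → y ≠ a → U a y := by
    intro y h1 h2 h3
    by_contra h6
    exact hbmin y h2 ⟨ha0, haN, h1, by omega, h3, h6⟩
  have hab : a < b := by
    by_contra hlt
    exact hUab (Usymm (hamin' b a hb0 (by omega) ha0 haN hba.symm))
  obtain ⟨c, hc⟩ : ∃ c, c = a ^^^ b := ⟨_, rfl⟩
  have hac : a ^^^ c = b := by rw [hc]; simp
  have hbc : b ^^^ c = a := by rw [hc, Nat.xor_comm a b]; simp
  have hc0 : c ≠ 0 := by rintro rfl; simp at hac; omega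
  have hca : c ≠ a := by rintro rfl; simp at hac; omega
  have hcb : c ≠ b := by rintro rfl; simp at hbc; omega
  have hcN : c < N := hc ▸ hpow a b haN hbN
  have hUac : ¬ U a c := fun hu => hUab (hac ▸ Uxor hu hca.symm)
  have hUbc : ¬ U b c := fun hu => hUab (Usymm (hbc ▸ Uxor hu hcb.symm))
  have hbc' : b < c := by
    by_contra hlt
    exact hUac (hbmin' c (by omega) (by omega) hca)
  have spec := h.2 i

  have L1 : ∀ j, j < a → ¬ B i j := by
    intro j hj hB
    have hj0 := (h.1 _ _ hB).2
    refine (spec j hi0 hj0).1 hB (Or.inr (Or.inr ?_))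
    apply h.full hN i H j hj0 (by omega)
    intro y h1 h2 h3
    exact (hU _ _).1 (hamin' j y hj0 hj h1 h2 h3)
  have blk : ∀ x j, B i x → x < j → U x j → ¬ B i j := by
    intro x j hx hxj hu hB
    obtain ⟨p, hp, h1, h2⟩ := (hU _ _).1 hu
    exact (spec j hi0 (by omega)).1 hB (Or.inl ⟨p, hp, x, hxj, hx, h2, h1⟩)
  have mkB : ∀ j, 0 < j → (∀ x < j, B i x → ¬ U x j) →
      (((Finset.range j).filter fun x => B i x).card < 3) →
      (∃ y, 0 < y ∧ y < N ∧ y ≠ j ∧ ¬ U j y) → j < N → B i j := by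
    rintro j hj h1 h2 ⟨y, h3, h4, h5, h6⟩ hjN
    rw [spec j hi0 hj]
    rintro (⟨p, hp, x, hx, k1, k2, k3⟩ | k | k)
    · exact h1 x hx k1 ((hU _ _).2 ⟨p, hp, k3, k2⟩)
    · have k' : 3 ≤ ((Finset.range j).filter fun x => B i x).card := by convert k
      omega
    · refine h.notfull hN i H j hj hjN y h3 h4 h5 (fun hh => h6 ((hU _ _).2 hh)) ?_
      convert k
  have Ba : B i a := by
    refine mkB a ha0 (fun x hx hB => absurd hB (L1 x hx)) ?_ ⟨b, hb0, hbN, hba, hUab⟩ haN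
    rw [Finset.filter_false_of_mem]
    · simp
    · intro x hx
      exact L1 x (Finset.mem_range.1 hx)
  have L2 : ∀ j, j < b → B i j → j = a := by
    intro j hj hB
    by_contra hne
    rcases lt_or_gt_of_ne hne with hl | hl
    · exact L1 j hl hB
    · exact blk a j Ba hl (hbmin' j (by omega) hj hne) hB
  have Bb : B i b := by
    refine mkB b hb0 ?_ ?_ ⟨a, ha0, haN, hba.symm, fun hu => hUab (Usymm hu)⟩ hbN
    · intro x hx hB
      rw [L2 x hx hB]
      exact hUab
    · have : ((Finset.range b).filter fun x => B i x) ⊆ {a} := by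
        intro x hx
        simp only [Finset.mem_filter, Finset.mem_range] at hx
        simp [L2 x hx.1 hx.2]
      have := Finset.card_le_card this
      simp at this
      omega
  have L3 : ∀ j, j < c → B i j → j = a ∨ j = b := by
    intro j hj hB
    by_contra hne
    push Not at hne
    have hbj : b < j := by
      by_contra hle
      exact hne.1 (L2 j (by omega) hB)
    have n1 : j ^^^ b ≠ 0 := by rw [Ne, Nat.xor_eq_zero_iff]; omega
    have n2 : j ^^^ a ≠ 0 := by rw [Ne, Nat.xor_eq_zero_iff]; omega
    have e1 : b ^^^ (j ^^^ b) = j := by rw [Nat.xor_comm j b]; simp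
    have e2 : a ^^^ (j ^^^ a) = j := by rw [Nat.xor_comm j a]; simp
    have m1 : b ≠ j ^^^ b := by intro hh; rw [← hh] at e1; simp at e1; omega
    have m2 : a ≠ j ^^^ a := by intro hh; rw [← hh] at e2; simp at e2; omega
    rw [hc] at hj
    rcases Nat.lt_xor_cases hj with hl | hl
    · have hu := Uxor (Usymm (hamin' (j ^^^ b) b (by omega) hl hb0 hbN m1)) m1
      rw [e1] at hu
      exact blk b j Bb hbj hu hB
    · have hu := Uxor (hbmin' (j ^^^ a) (by omega) hl m2.symm) m2
      rw [e2] at hu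
      exact blk a j Ba (by omega) hu hB
  have Bc : B i c := by
    refine mkB c (by omega) ?_ ?_ ⟨a, ha0, haN, hca.symm, fun hu => hUac (Usymm hu)⟩ hcN
    · intro x hx hB
      rcases L3 x hx hB with rfl | rfl
      · exact hUac
      · exact hUbc
    · have : ((Finset.range c).filter fun x => B i x) ⊆ {a, b} := by
        intro x hx
        simp only [Finset.mem_filter, Finset.mem_range] at hx
        simpa using L3 x hx.1 hx.2
      have := Finset.card_le_card this
      have h2 := Finset.card_le_two (a := a) (b := b)
      omega
  refine ⟨a, b, ha0, hab, hc ▸ hbc', hc ▸ hcN, fun j => ?_⟩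
  rw [← hc]
  constructor
  · intro hB
    rcases lt_trichotomy j c with hl | hl | hl
    · rcases L3 j hl hB with k | k
      · exact Or.inl k
      · exact Or.inr (Or.inl k)
    · exact Or.inr (Or.inr hl)
    · exfalso
      refine (spec j hi0 (by omega)).1 hB (Or.inr (Or.inl ?_))
      have hs : ({a, b, c} : Finset ℕ) ⊆ ((Finset.range j).filter fun x => B i x) := by
        intro x hx
        simp only [Finset.mem_insert, Finset.mem_singleton] at hx
        simp only [Finset.mem_filter, Finset.mem_range]
        rcases hx with rfl | rfl | rfl
        · exact ⟨by omega, Ba⟩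
        · exact ⟨by omega, Bb⟩
        · exact ⟨by omega, Bc⟩
      have h3 : ({a, b, c} : Finset ℕ).card = 3 :=
        Finset.card_eq_three.2 ⟨a, b, c, by omega, by omega, by omega, rfl⟩
      have h4 := Finset.card_le_card hs
      rw [h3] at h4
      convert h4
  · rintro (rfl | rfl | rfl)
    · exact Ba
    · exact Bb
    · exact Bc

lemma card_pnat_filter (m : ℕ+) (P : ℕ → Prop) [DecidablePred P] (hP : ¬ P 0) (Q : ℕ+ → Prop)
    [DecidablePred Q] (hPQ : ∀ x : ℕ+, P x ↔ Q x) :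
    ((Finset.range m).filter P).card = ((Finset.Ico 1 m).filter Q).card := by
  symm
  apply Finset.card_bij (fun (x : ℕ+) _ => (x : ℕ))
  · intro x hx
    simp only [Finset.mem_filter, Finset.mem_Ico, Finset.mem_range] at *
    exact ⟨by exact_mod_cast hx.1.2, (hPQ x).2 hx.2⟩
  · intro x _ y _ hxy
    exact PNat.coe_injective hxy
  · intro x hx
    simp only [Finset.mem_filter, Finset.mem_range] at hx
    have hx0 : 0 < x := by
      rcases Nat.eq_zero_or_pos x with h0 | h0
      · exact absurd (h0 ▸ hx.2) hP
      · exact h0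
    obtain ⟨X, rfl⟩ : ∃ X : ℕ+, (X : ℕ) = x := ⟨x.toPNat hx0, rfl⟩
    refine ⟨X, ?_, rfl⟩
    rw [Finset.mem_filter, Finset.mem_Ico]
    refine ⟨⟨PNat.one_le _, ?_⟩, (hPQ X).1 hx.2⟩
    exact_mod_cast hx.1

/-- The naive matrix as a relation on natural numbers. -/
def NB (A : ℕ+ → ℕ+ → Bool) (i j : ℕ) : Prop :=
  ∃ I J : ℕ+, (I : ℕ) = i ∧ (J : ℕ) = j ∧ A I J = true

lemma NB_coe (A : ℕ+ → ℕ+ → Bool) (I J : ℕ+) : NB A I J ↔ A I J = true := by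
  constructor
  · rintro ⟨I', J', h1, h2, h⟩
    rwa [← PNat.coe_injective h1, ← PNat.coe_injective h2]
  · exact fun h => ⟨I, J, rfl, rfl, h⟩

lemma NB_pos {A : ℕ+ → ℕ+ → Bool} {i j : ℕ} (h : NB A i j) : 0 < i ∧ 0 < j := by
  obtain ⟨I, J, rfl, rfl, _⟩ := h
  exact ⟨I.2, J.2⟩

lemma natSpec_of_naive {r : ℕ} {A : ℕ+ → ℕ+ → Bool} (hA : IsNaiveMatrix 3 r A) :
    NatSpec r (NB A) := by
  classical
  refine ⟨fun i j h => NB_pos h, fun i j hi hj => ?_⟩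
  obtain ⟨I, rfl⟩ : ∃ X : ℕ+, (X : ℕ) = i := ⟨i.toPNat hi, rfl⟩
  obtain ⟨J, rfl⟩ : ∃ X : ℕ+, (X : ℕ) = j := ⟨j.toPNat hj, rfl⟩
  have h := hA I J
  have c1 := card_pnat_filter J (fun j' => NB A I j') (fun h => absurd (NB_pos h).2 (by simp))
    (fun j' => A I j' = true) (fun x => NB_coe A I x)
  have c2 := card_pnat_filter I (fun i' => NB A i' J) (fun h => absurd (NB_pos h).1 (by simp))
    (fun i' => A i' J = true) (fun x => NB_coe A x J)
  have e1 : (∃ i' < I, ∃ j' < J, A I j' = true ∧ A i' J = true ∧ A i' j' = true) ↔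
      (∃ i' < (I : ℕ), ∃ j' < (J : ℕ), NB A I j' ∧ NB A i' J ∧ NB A i' j') := by
    constructor
    · rintro ⟨p, hp, q, hq, h1, h2, h3⟩
      exact ⟨p, hp, q, hq, (NB_coe _ _ _).2 h1, (NB_coe _ _ _).2 h2, (NB_coe _ _ _).2 h3⟩
    · rintro ⟨p, hp, q, hq, h1, h2, ⟨P, Q, rfl, rfl, h3⟩⟩
      exact ⟨P, hp, Q, hq, (NB_coe _ _ _).1 h1, (NB_coe _ _ _).1 h2, h3⟩
  rw [← c1, ← c2, e1] at h
  rw [NB_coe, h]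

/-- Main theorem: for `k = 3`, `r = 2 ^ n - 1` (`n ≥ 1`) and
`d = (2 ^ (n+1) - 1) * (2 ^ n - 1) / 3`, every one of the first `d` rows of the naive
matrix of type `(k, r)` has support of the form `{a, b, a ⊕ b}` with
`0 < a < b < a ⊕ b < 2 ^ (n+1)`, where `⊕` (`^^^`) is Nim addition (bitwise XOR). -/
theorem naive_matrix_rows_nim (n : ℕ) (hn : 1 ≤ n)
    (A : ℕ+ → ℕ+ → Bool) (hA : IsNaiveMatrix 3 (2 ^ n - 1) A)
    (d : ℕ) (hd : d = (2 ^ (n + 1) - 1) * (2 ^ n - 1) / 3)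
    (i : ℕ+) (hi : (i : ℕ) ≤ d) :
    ∃ a b : ℕ, 0 < a ∧ a < b ∧ b < a ^^^ b ∧ a ^^^ b < 2 ^ (n + 1) ∧
      ∀ j : ℕ+, A i j = true ↔ ((j : ℕ) = a ∨ (j : ℕ) = b ∨ (j : ℕ) = a ^^^ b) := by
  have hs := natSpec_of_naive hA
  have hN : 2 ^ (n + 1) = 2 * (2 ^ n - 1) + 2 := by
    have : 0 < 2 ^ n := by positivity
    rw [pow_succ]
    omega
  have key : ∀ m : ℕ, 0 < m → m ≤ d → LineRow (2 ^ (n + 1)) (NB A) m := by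
    intro m
    induction m using Nat.strong_induction_on with
    | _ m ih =>
      intro h0 hm
      refine hs.step hN (fun x y hx hy => Nat.xor_lt_two_pow hx hy) m h0 ?_
        (fun p hp hp0 => ih p hp hp0 (by omega))
      omega
  obtain ⟨a, b, h1, h2, h3, h4, h5⟩ := key i i.2 hi
  refine ⟨a, b, h1, h2, h3, h4, fun j => ?_⟩
  rw [← h5 j, NB_coe]
end

section
/- Let n ≥ 1, k = 3, r = 2^n − 1, d = (2^{n+1} − 1)(2^n − 1)/3, and let A be the naive matrix of type (k,r). Then the map i ↦ L_i = {j : A(i,j) = 1} is a bijection from {1, ..., d} onto the set of all 3-element subsets {a, b, a ⊕ b} of {1, ..., 2^{n+1} − 1} with 0 < a < b < a ⊕ b < 2^{n+1}; that is, the first d rows of A are pairwise distinct and their supports are exactly the sets of nonzero elements of the subgroups of order 4 of ({0, ..., 2^{n+1} − 1}, ⊕). -/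
namespace NaiveAux

/-- `x` lies on the line spanned by the pair `p`. -/
def OnLine (x : ℕ) (p : ℕ ×ₗ ℕ) : Prop :=
  x = (ofLex p).1 ∨ x = (ofLex p).2 ∨ x = (ofLex p).1 ^^^ (ofLex p).2

instance (x : ℕ) (p : ℕ ×ₗ ℕ) : Decidable (OnLine x p) := by
  unfold OnLine; infer_instance

/-- `p = (a, b)` codes a line `a < b < a ^^^ b < N`. -/
def IsLn (N : ℕ) (p : ℕ ×ₗ ℕ) : Prop :=
  0 < (ofLex p).1 ∧ (ofLex p).1 < (ofLex p).2 ∧ (ofLex p).2 < (ofLex p).1 ^^^ (ofLex p).2 ∧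
    (ofLex p).1 ^^^ (ofLex p).2 < N

instance (N : ℕ) (p : ℕ ×ₗ ℕ) : Decidable (IsLn N p) := by
  unfold IsLn; infer_instance

/-- The finite set of all lines. -/
def Lns (N : ℕ) : Finset (ℕ ×ₗ ℕ) :=
  ((Finset.range N ×ˢ Finset.range N).map toLex.toEmbedding).filter (IsLn N)

lemma mem_Lns {N : ℕ} {p : ℕ ×ₗ ℕ} : p ∈ Lns N ↔ IsLn N p := by
  unfold Lns
  simp only [Finset.mem_filter, Finset.mem_map, Finset.mem_product, Finset.mem_range]
  constructor
  · exact fun h => h.2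
  · intro h
    refine ⟨⟨ofLex p, ?_, rfl⟩, h⟩
    obtain ⟨_, _, _, _⟩ := h
    constructor <;> omega

lemma xor_xor_self (x y : ℕ) : x ^^^ (x ^^^ y) = y := by
  rw [← Nat.xor_assoc, Nat.xor_self, Nat.zero_xor]

lemma xor_self_xor (x y : ℕ) : (x ^^^ y) ^^^ x = y := by
  rw [Nat.xor_comm, xor_xor_self]

lemma xor_self_xor' (x y : ℕ) : (x ^^^ y) ^^^ y = x := by
  rw [Nat.xor_comm x y, xor_self_xor]

lemma xor_self_xor'' (x y : ℕ) : y ^^^ (x ^^^ y) = x := by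
  rw [Nat.xor_comm x y, xor_xor_self]

lemma xor_ne (x y : ℕ) (hx : 0 < x) (hy : 0 < y) (h : x ≠ y) :
    x ^^^ y ≠ x ∧ x ^^^ y ≠ y ∧ 0 < x ^^^ y := by
  have h1 := xor_xor_self x y
  have h2 := xor_self_xor' x y
  refine ⟨fun e => ?_, fun e => ?_, Nat.pos_of_ne_zero fun e => ?_⟩
  · rw [e, Nat.xor_self] at h1; omega
  · rw [e, Nat.xor_self] at h2; omega
  · rw [e, Nat.xor_zero] at h1; omega

lemma line_cases {N x y : ℕ} {p : ℕ ×ₗ ℕ} (hp : IsLn N p) (hxy : x < y)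
    (hx : OnLine x p) (hy : OnLine y p) :
    (y < x ^^^ y ∧ p = toLex (x, y)) ∨ (x < x ^^^ y ∧ x ^^^ y < y ∧ p = toLex (x, x ^^^ y)) ∨
      (x ^^^ y < x ∧ p = toLex (x ^^^ y, x)) := by
  obtain ⟨a, b⟩ := p
  simp only [OnLine, IsLn] at *
  change (0 < a ∧ a < b ∧ b < a ^^^ b ∧ a ^^^ b < N) at hp
  change (x = a ∨ x = b ∨ x = a ^^^ b) at hx
  change (y = a ∨ y = b ∨ y = a ^^^ b) at hy
  rcases hx with rfl | rfl | rfl <;> rcases hy with rfl | rfl | rfl <;>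
    first
    | omega
    | exact Or.inl ⟨hp.2.2.1, rfl⟩
    | (simp only [xor_xor_self, xor_self_xor'']
       first
       | exact Or.inr (Or.inl ⟨hp.2.1, hp.2.2.1, rfl⟩)
       | exact Or.inr (Or.inr ⟨hp.2.1, rfl⟩))

lemma line_unique {N x y : ℕ} {p q : ℕ ×ₗ ℕ} (hp : IsLn N p) (hq : IsLn N q) (hxy : x < y)
    (hx : OnLine x p) (hy : OnLine y p) (hx' : OnLine x q) (hy' : OnLine y q) : p = q := by
  rcases line_cases hp hxy hx hy with h | h | h <;>
    rcases line_cases hq hxy hx' hy' with h' | h' | h' <;>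
    first
    | omega
    | (have h1 := h.2; have h2 := h'.2; rw [h1, h2])
    | (have h1 := h.2.2; have h2 := h'.2.2; rw [h1, h2])

lemma line_exists {m x y : ℕ} (hx : 0 < x) (hxy : x < y) (hy : y < 2 ^ m) :
    ∃ p, IsLn (2 ^ m) p ∧ OnLine x p ∧ OnLine y p := by
  obtain ⟨h1, h2, h3⟩ := xor_ne x y hx (by omega) (by omega)
  have h4 : x ^^^ y < 2 ^ m := Nat.xor_lt_two_pow (by omega) hy
  rcases lt_or_gt_of_ne h2 with h | h
  · rcases lt_or_gt_of_ne h1 with h' | h'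
    · refine ⟨toLex (x ^^^ y, x), ?_, ?_, ?_⟩
      · simp only [IsLn, ofLex_toLex, xor_self_xor]; omega
      · simp [OnLine]
      · simp [OnLine, xor_self_xor]
    · refine ⟨toLex (x, x ^^^ y), ?_, ?_, ?_⟩
      · simp only [IsLn, ofLex_toLex, xor_xor_self]; omega
      · simp [OnLine]
      · simp [OnLine, xor_xor_self]
  · refine ⟨toLex (x, y), ?_, ?_, ?_⟩
    · simp only [IsLn, ofLex_toLex]; omega
    · simp [OnLine]
    · simp [OnLine]

/-- The lines through `x`. -/
def Inc (N x : ℕ) : Finset (ℕ ×ₗ ℕ) := (Lns N).filter (OnLine x)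

lemma card_half {n x : ℕ} (hx : 0 < x) (hxN : x < 2 ^ (n + 1)) :
    ((Finset.range (2 ^ (n + 1))).filter fun y => 0 < y ∧ y < x ^^^ y).card = 2 ^ n - 1 := by
  set R := Finset.range (2 ^ (n + 1)) with hR
  have hne : ∀ y, x ^^^ y ≠ y := by
    intro y e
    have h2 := xor_self_xor' x y
    rw [e, Nat.xor_self] at h2; omega
  have h1 : (R.filter fun y => y < x ^^^ y).card = (R.filter fun y => ¬ y < x ^^^ y).card := by
    refine Finset.card_bij' (fun y _ => x ^^^ y) (fun y _ => x ^^^ y) ?_ ?_ ?_ ?_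
    · intro y hy
      simp only [hR, Finset.mem_filter, Finset.mem_range] at hy ⊢
      refine ⟨Nat.xor_lt_two_pow hxN hy.1, ?_⟩
      rw [xor_xor_self]; omega
    · intro y hy
      simp only [hR, Finset.mem_filter, Finset.mem_range] at hy ⊢
      refine ⟨Nat.xor_lt_two_pow hxN hy.1, ?_⟩
      rw [xor_xor_self]; have := hne y; omega
    · intro y _; exact xor_xor_self x y
    · intro y _; exact xor_xor_self x y
  have h2 := Finset.card_filter_add_card_filter_not (s := R) (fun y => y < x ^^^ y)
  have h3 : (R.filter fun y => 0 < y ∧ y < x ^^^ y) = (R.filter fun y => y < x ^^^ y).erase 0 := by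
    ext y
    simp only [Finset.mem_filter, Finset.mem_erase]
    constructor
    · rintro ⟨h, h', h''⟩; exact ⟨by omega, h, h''⟩
    · rintro ⟨h, h', h''⟩; exact ⟨h', by omega, h''⟩
  rw [h3, Finset.card_erase_of_mem]
  · have : R.card = 2 ^ (n + 1) := Finset.card_range _
    rw [pow_succ] at this
    omega
  · simp [hR, hx]

lemma card_Inc {n x : ℕ} (hx : 0 < x) (hxN : x < 2 ^ (n + 1)) :
    (Inc (2 ^ (n + 1)) x).card = 2 ^ n - 1 := by
  rw [← card_half hx hxN]
  symm
  have hdata : ∀ y, y < 2 ^ (n + 1) → 0 < y → y < x ^^^ y →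
      ∃ p, IsLn (2 ^ (n + 1)) p ∧ OnLine x p ∧ OnLine y p := by
    intro y hy h0 h1
    have hne : x ≠ y := by rintro rfl; simp at h1
    rcases lt_or_gt_of_ne hne with h | h
    · exact line_exists hx h hy
    · obtain ⟨p, hp, h1, h2⟩ := line_exists h0 h hxN
      exact ⟨p, hp, h2, h1⟩
  choose! f hf1 hf2 hf3 using hdata
  refine Finset.card_bij (fun y _ => f y) ?_ ?_ ?_
  · intro y hy
    simp only [Finset.mem_filter, Finset.mem_range, Inc, mem_Lns] at hy ⊢
    exact ⟨hf1 y hy.1 hy.2.1 hy.2.2, hf2 y hy.1 hy.2.1 hy.2.2⟩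
  · intro y hy z hz e
    simp only [Finset.mem_filter, Finset.mem_range] at hy hz
    have a1 := hf1 y hy.1 hy.2.1 hy.2.2
    have a2 := hf2 y hy.1 hy.2.1 hy.2.2
    have a3 := hf3 y hy.1 hy.2.1 hy.2.2
    have b3 := hf3 z hz.1 hz.2.1 hz.2.2
    rw [← e] at b3
    have hne : x ≠ y := by rintro rfl; simp at hy
    have hne' : x ≠ z := by rintro rfl; simp at hz
    obtain ⟨q1, q2, q3, q4⟩ := a1
    have hy' := hy.2.2
    have hz' := hz.2.2
    unfold OnLine at a2 a3 b3
    generalize (ofLex (f y)).1 = a at *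
    generalize (ofLex (f y)).2 = b at *
    rcases a2 with rfl | rfl | rfl <;> rcases a3 with rfl | rfl | rfl <;>
      rcases b3 with rfl | rfl | rfl <;>
      first
      | rfl
      | omega
      | (simp only [xor_xor_self, xor_self_xor, xor_self_xor', xor_self_xor''] at hy' hz'; omega)
      | (rw [Nat.xor_comm] at hy'; omega)
      | (rw [Nat.xor_comm] at hz'; omega)
  · intro p hp
    simp only [Finset.mem_filter, Inc, mem_Lns] at hp
    obtain ⟨hp, hxp⟩ := hp
    have key : ∃ y, 0 < y ∧ y < 2 ^ (n + 1) ∧ y < x ^^^ y ∧ x ≠ y ∧ OnLine y p := by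
      have hp' := hp
      obtain ⟨q1, q2, q3, q4⟩ := hp'
      rcases hxp with h | h | h
      · refine ⟨(ofLex p).2, by omega, by omega, by rw [h]; omega, by omega, by simp [OnLine]⟩
      · refine ⟨(ofLex p).1, by omega, by omega, by rw [h, Nat.xor_comm]; omega, by omega,
          by simp [OnLine]⟩
      · refine ⟨(ofLex p).1, by omega, by omega, by rw [h, xor_self_xor]; omega, by omega,
          by simp [OnLine]⟩
    obtain ⟨y, hy0, hyN, hy, hne, hyp⟩ := key
    refine ⟨y, by simp [hy0, hyN, hy], ?_⟩
    rcases lt_or_gt_of_ne hne with h | h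
    · exact line_unique (hf1 y hyN hy0 hy) hp h (hf2 y hyN hy0 hy) (hf3 y hyN hy0 hy) hxp hyp
    · exact line_unique (hf1 y hyN hy0 hy) hp h (hf3 y hyN hy0 hy) (hf2 y hyN hy0 hy) hyp hxp

lemma card_Lns (n : ℕ) :
    3 * (Lns (2 ^ (n + 1))).card = (2 ^ (n + 1) - 1) * (2 ^ n - 1) := by
  have h := Finset.sum_card_bipartiteAbove_eq_sum_card_bipartiteBelow
    (s := Finset.Ico 1 (2 ^ (n + 1))) (t := Lns (2 ^ (n + 1))) OnLine
  have h1 : ∀ x ∈ Finset.Ico 1 (2 ^ (n + 1)),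
      (Finset.bipartiteAbove OnLine (Lns (2 ^ (n + 1))) x).card = 2 ^ n - 1 := by
    intro x hx
    rw [Finset.mem_Ico] at hx
    exact card_Inc (by omega) hx.2
  have h2 : ∀ p ∈ Lns (2 ^ (n + 1)),
      (Finset.bipartiteBelow OnLine (Finset.Ico 1 (2 ^ (n + 1))) p).card = 3 := by
    intro p hp
    rw [mem_Lns] at hp
    obtain ⟨q1, q2, q3, q4⟩ := hp
    rw [Finset.card_eq_three]
    refine ⟨(ofLex p).1, (ofLex p).2, (ofLex p).1 ^^^ (ofLex p).2, by omega, by omega, by omega, ?_⟩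
    ext x
    simp only [Finset.mem_bipartiteBelow, Finset.mem_Ico, OnLine, Finset.mem_insert,
      Finset.mem_singleton]
    omega
  rw [Finset.sum_congr rfl h1, Finset.sum_congr rfl h2] at h
  simp only [Finset.sum_const, Nat.card_Ico, smul_eq_mul] at h
  omega

/-- One greedy row. -/
lemma row_step {r : ℕ} {A : ℕ+ → ℕ+ → Bool} (hA : IsNaiveMatrix 3 r A) (i a b c : ℕ+)
    (hab : a < b) (hbc : b < c)
    (F1 : ∀ j < a, r ≤ ((Finset.Ico 1 i).filter fun i' => A i' j = true).card)
    (F2 : ∀ j, j = a ∨ j = b ∨ j = c →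
      ¬ r ≤ ((Finset.Ico 1 i).filter fun i' => A i' j = true).card)
    (F3 : ∀ j, a < j → j < b → ∃ i' < i, A i' j = true ∧ A i' a = true)
    (F4 : ∀ j, b < j → j < c → (∃ i' < i, A i' j = true ∧ A i' a = true) ∨
      (∃ i' < i, A i' j = true ∧ A i' b = true))
    (F5 : ∀ x y, x < y → (x = a ∨ x = b ∨ x = c) → (y = a ∨ y = b ∨ y = c) →
      ¬ ∃ i' < i, A i' y = true ∧ A i' x = true) (j : ℕ+) :
    A i j = true ↔ j = a ∨ j = b ∨ j = c := by
  have s1 : ∀ j < a, ¬ A i j = true := fun j hj h => (hA i j).1 h (Or.inr (Or.inr (F1 j hj)))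
  have mk : ∀ j, (j = a ∨ j = b ∨ j = c) →
      (∀ j' < j, A i j' = true → j' = a ∨ j' = b ∨ j' = c) → A i j = true := by
    intro j hj hlt
    rw [hA i j]
    rintro (⟨i', hi', j', hj', h1, h2, h3⟩ | h | h)
    · exact F5 j' j hj' (hlt j' hj' h1) hj ⟨i', hi', h2, h3⟩
    · have hsub : ((Finset.Ico 1 j).filter fun j' => A i j' = true) ⊆ {a, b} := by
        intro j' hj'
        simp only [Finset.mem_filter, Finset.mem_Ico] at hj'
        have h0 := hlt j' hj'.1.2 hj'.2
        simp only [Finset.mem_insert, Finset.mem_singleton]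
        rcases h0 with h0 | h0 | h0
        · exact Or.inl h0
        · exact Or.inr h0
        · exfalso
          have h4 := hj'.1.2
          rw [h0] at h4
          rcases hj with rfl | rfl | rfl
          · exact absurd (h4.trans hab) (not_lt.2 hbc.le)
          · exact absurd h4 (not_lt.2 hbc.le)
          · exact lt_irrefl _ h4
      have := (Finset.card_le_card hsub).trans Finset.card_le_two
      omega
    · exact F2 j hj h
  have ta : A i a = true := mk a (Or.inl rfl) fun j' hj' h => absurd h (s1 j' hj')
  have s2 : ∀ j, a < j → j < b → ¬ A i j = true := by
    intro j h1 h2 h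
    obtain ⟨i', hi', h3, h4⟩ := F3 j h1 h2
    exact (hA i j).1 h (Or.inl ⟨i', hi', a, h1, ta, h3, h4⟩)
  have l2 : ∀ j' < b, A i j' = true → j' = a ∨ j' = b ∨ j' = c := by
    intro j' hj' h
    rcases lt_trichotomy j' a with h1 | h1 | h1
    · exact absurd h (s1 j' h1)
    · exact Or.inl h1
    · exact absurd h (s2 j' h1 hj')
  have tb : A i b = true := mk b (Or.inr (Or.inl rfl)) l2
  have s3 : ∀ j, b < j → j < c → ¬ A i j = true := by
    intro j h1 h2 h
    rcases F4 j h1 h2 with ⟨i', hi', h3, h4⟩ | ⟨i', hi', h3, h4⟩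
    · exact (hA i j).1 h (Or.inl ⟨i', hi', a, hab.trans h1, ta, h3, h4⟩)
    · exact (hA i j).1 h (Or.inl ⟨i', hi', b, h1, tb, h3, h4⟩)
  have l3 : ∀ j' < c, A i j' = true → j' = a ∨ j' = b ∨ j' = c := by
    intro j' hj' h
    rcases lt_trichotomy j' b with h1 | h1 | h1
    · exact l2 j' h1 h
    · exact Or.inr (Or.inl h1)
    · exact absurd h (s3 j' h1 hj')
  have tc : A i c = true := mk c (Or.inr (Or.inr rfl)) l3
  constructor
  · intro h
    rcases lt_trichotomy j c with h1 | h1 | h1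
    · exact l3 j h1 h
    · exact Or.inr (Or.inr h1)
    · exfalso
      refine (hA i j).1 h (Or.inr (Or.inl ?_))
      have hsub : ({a, b, c} : Finset ℕ+) ⊆ ((Finset.Ico 1 j).filter fun j' => A i j' = true) := by
        intro x hx
        simp only [Finset.mem_insert, Finset.mem_singleton] at hx
        simp only [Finset.mem_filter, Finset.mem_Ico]
        rcases hx with rfl | rfl | rfl
        · exact ⟨⟨PNat.one_le _, (hab.trans hbc).trans h1⟩, ta⟩
        · exact ⟨⟨PNat.one_le _, hbc.trans h1⟩, tb⟩
        · exact ⟨⟨PNat.one_le _, h1⟩, tc⟩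
      have h3 := Finset.card_le_card hsub
      rwa [Finset.card_eq_three.2 ⟨a, b, c, hab.ne, (hab.trans hbc).ne, hbc.ne, rfl⟩] at h3
  · rintro (rfl | rfl | rfl) <;> assumption

lemma rows (n : ℕ) (A : ℕ+ → ℕ+ → Bool) (hA : IsNaiveMatrix 3 (2 ^ n - 1) A)
    (d : ℕ) (hd : (Lns (2 ^ (n + 1))).card = d) (q : Fin d) (j : ℕ+) :
    A ⟨q + 1, Nat.succ_pos _⟩ j = true ↔
      OnLine j ((Lns (2 ^ (n + 1))).orderEmbOfFin hd q) := by
  induction q using WellFoundedLT.induction generalizing j with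
  | ind q ih =>
  set e := (Lns (2 ^ (n + 1))).orderEmbOfFin hd with he
  have hLn : ∀ q, IsLn (2 ^ (n + 1)) (e q) := fun q =>
    mem_Lns.1 (Finset.orderEmbOfFin_mem _ hd q)
  have hsurj : ∀ p, IsLn (2 ^ (n + 1)) p → ∃ q, e q = p := by
    intro p hp
    have : p ∈ Set.range e := by
      rw [he, Finset.range_orderEmbOfFin]; exact mem_Lns.2 hp
    exact this
  set i : ℕ+ := ⟨q + 1, Nat.succ_pos _⟩ with hi
  -- earlier rows
  have hprev : ∀ i' < i, ∃ q' < q, i' = ⟨q' + 1, Nat.succ_pos _⟩ := by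
    intro i' hi'
    have h1 : (i' : ℕ) < q + 1 := hi'
    have h2 := i'.pos
    refine ⟨⟨i' - 1, by omega⟩, ?_, ?_⟩
    · rw [Fin.lt_def]; simp only; omega
    · apply PNat.eq; simp only [PNat.mk_coe]; omega
  have hlt : ∀ q' < q, (⟨q' + 1, Nat.succ_pos _⟩ : ℕ+) < i := by
    intro q' h
    rw [Fin.lt_def] at h
    change (q' : ℕ) + 1 < q + 1
    omega
  have hcol : ∀ x : ℕ+, ((Finset.Ico 1 i).filter fun i' => A i' x = true).card =
      ((Inc (2 ^ (n + 1)) x).filter (· < e q)).card := by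
    intro x
    symm
    haveI : Nonempty (Fin d) := ⟨q⟩
    choose! g hg using hsurj
    refine Finset.card_bij (fun p _ => ⟨(g p : ℕ) + 1, Nat.succ_pos _⟩) ?_ ?_ ?_
    · intro p hp
      simp only [Finset.mem_filter, Inc, mem_Lns] at hp
      have h1 : g p < q := by rw [← e.lt_iff_lt, hg p hp.1.1]; exact hp.2
      refine Finset.mem_filter.2 ⟨Finset.mem_Ico.2 ⟨PNat.one_le _, hlt _ h1⟩, ?_⟩
      refine (ih _ h1 x).2 ?_
      rw [hg p hp.1.1]; exact hp.1.2
    · intro p hp p' hp' h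
      simp only [Finset.mem_filter, Inc, mem_Lns] at hp hp'
      have h1 : (g p : ℕ) + 1 = g p' + 1 := congrArg PNat.val h
      have h2 : g p = g p' := Fin.ext (by omega)
      rw [← hg p hp.1.1, h2, hg p' hp'.1.1]
    · intro i' hi'
      simp only [Finset.mem_filter, Finset.mem_Ico] at hi'
      obtain ⟨q', hq', rfl⟩ := hprev i' hi'.1.2
      have h1 := (ih q' hq' x).1 hi'.2
      refine ⟨e q', ?_, ?_⟩
      · simp only [Finset.mem_filter, Inc, mem_Lns]
        exact ⟨⟨hLn q', h1⟩, e.lt_iff_lt.2 hq'⟩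
      · have h2 : g (e q') = q' := e.injective (hg _ (hLn q'))
        simp only [h2]
        rfl
  have hcoll : ∀ x y : ℕ+, (∃ i' < i, A i' x = true ∧ A i' y = true) ↔
      ∃ p < e q, IsLn (2 ^ (n + 1)) p ∧ OnLine x p ∧ OnLine y p := by
    intro x y
    constructor
    · rintro ⟨i', hi', h1, h2⟩
      obtain ⟨q', hq', rfl⟩ := hprev i' hi'
      exact ⟨e q', e.lt_iff_lt.2 hq', hLn q', (ih q' hq' x).1 h1, (ih q' hq' y).1 h2⟩
    · rintro ⟨p, hp, hp', h1, h2⟩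
      obtain ⟨q', rfl⟩ := hsurj p hp'
      have hq' := e.lt_iff_lt.1 hp
      exact ⟨_, hlt q' hq', (ih q' hq' x).2 h1, (ih q' hq' y).2 h2⟩
  have hq := hLn q
  have hq0 := hq
  obtain ⟨h1, h2, h3, h4⟩ := hq0
  obtain ⟨a, ha⟩ : ∃ a, a = (ofLex (e q)).1 := ⟨_, rfl⟩
  obtain ⟨b, hb⟩ : ∃ b, b = (ofLex (e q)).2 := ⟨_, rfl⟩
  have heq : e q = toLex (a, b) := by rw [ha, hb]; rfl
  have hOn : ∀ x, OnLine x (e q) ↔ x = a ∨ x = b ∨ x = a ^^^ b := by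
    intro x; rw [ha, hb]; rfl
  rw [← ha, ← hb] at h3 h4
  rw [← ha, ← hb] at h2
  rw [← ha] at h1
  have hlex : ∀ u v, toLex (u, v) < e q ↔ u < a ∨ u = a ∧ v < b := by
    intro u v
    rw [heq, Prod.Lex.toLex_lt_toLex]
  obtain ⟨aP, haP⟩ : ∃ x : ℕ+, (x : ℕ) = a := ⟨⟨a, h1⟩, rfl⟩
  obtain ⟨bP, hbP⟩ : ∃ x : ℕ+, (x : ℕ) = b := ⟨⟨b, by omega⟩, rfl⟩
  obtain ⟨cP, hcP⟩ : ∃ x : ℕ+, (x : ℕ) = a ^^^ b := ⟨⟨a ^^^ b, by omega⟩, rfl⟩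
  have hP : ∀ x : ℕ+, OnLine x (e q) ↔ x = aP ∨ x = bP ∨ x = cP := by
    intro x
    rw [hOn, ← haP, ← hbP, PNat.coe_inj, PNat.coe_inj, haP, hbP, ← hcP, PNat.coe_inj]
  have key := row_step hA i aP bP cP (by rw [← PNat.coe_lt_coe, haP, hbP]; exact h2)
    (by rw [← PNat.coe_lt_coe, hbP, hcP]; exact h3)
    ?_ ?_ ?_ ?_ ?_ j
  · rw [key, hP]
  · intro x hx
    have hx' : (x : ℕ) < a := by rw [← haP]; exact hx
    rw [hcol, Finset.filter_true_of_mem, card_Inc x.pos (by omega)]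
    intro p hp
    simp only [Inc, Finset.mem_filter, mem_Lns] at hp
    obtain ⟨⟨p1, p2, p3, p4⟩, p5⟩ := hp
    have : p = toLex ((ofLex p).1, (ofLex p).2) := rfl
    rw [this, hlex]
    unfold OnLine at p5
    omega
  · intro x hx
    rw [hcol, not_le]
    have hx' : OnLine x (e q) := (hP x).2 hx
    have hxN : (x : ℕ) < 2 ^ (n + 1) := by
      rw [hOn] at hx'; omega
    rw [← card_Inc x.pos hxN]
    apply Finset.card_lt_card
    rw [Finset.filter_ssubset]
    refine ⟨e q, ?_, lt_irrefl _⟩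
    simp only [Inc, Finset.mem_filter, mem_Lns]
    exact ⟨hq, hx'⟩
  · intro x hx hx'
    have hx : a < (x : ℕ) := by rw [← haP]; exact hx
    have hx' : (x : ℕ) < b := by rw [← hbP]; exact hx'
    rw [hcoll, haP]
    obtain ⟨p, hp, hpa, hpx⟩ := line_exists (m := n + 1) h1 hx (by omega)
    refine ⟨p, ?_, hp, hpx, hpa⟩
    rcases line_cases hp hx hpa hpx with h | h | h
    · rw [h.2, hlex]; omega
    · rw [h.2.2, hlex]; omega
    · rw [h.2, hlex]; omega
  · intro x hx hx'
    have hx : b < (x : ℕ) := by rw [← hbP]; exact hx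
    have hx' : (x : ℕ) < a ^^^ b := by rw [← hcP]; exact hx'
    rw [hcoll, hcoll, haP, hbP]
    rcases Nat.lt_xor_cases hx' with h | h
    · right
      rw [Nat.xor_comm] at h
      obtain ⟨p, hp, hpa, hpx⟩ := line_exists (m := n + 1) (by omega) hx (by omega)
      refine ⟨p, ?_, hp, hpx, hpa⟩
      rcases line_cases hp hx hpa hpx with h | h | h
      · omega
      · omega
      · rw [h.2, hlex]; omega
    · left
      rw [Nat.xor_comm] at h
      have hax : a < (x : ℕ) := by omega
      obtain ⟨p, hp, hpa, hpx⟩ := line_exists (m := n + 1) h1 hax (by omega)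
      refine ⟨p, ?_, hp, hpx, hpa⟩
      rcases line_cases hp hax hpa hpx with h | h | h
      · omega
      · rw [h.2.2, hlex]; omega
      · rw [h.2, hlex]; omega
  · intro x y hxy hx hy
    rw [hcoll]
    rintro ⟨p, hp, hp', h5, h6⟩
    have hx' : OnLine x (e q) := (hP x).2 hx
    have hy' : OnLine y (e q) := (hP y).2 hy
    exact hp.ne (line_unique hp' hq hxy h6 h5 hx' hy')

end NaiveAux

/-- For `k = 3`, `r = 2 ^ n - 1` (`n ≥ 1`) and `d = (2 ^ (n+1) - 1) * (2 ^ n - 1) / 3`,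
the map sending `i` to the support `Lᵢ = {j | A i j = 1}` of the `i`-th row of the naive
matrix of type `(k, r)` is a bijection from `{1, …, d}` onto the set of all 3-element
subsets `{a, b, a ^^^ b}` of `{1, …, 2 ^ (n+1) - 1}` with
`0 < a < b < a ^^^ b < 2 ^ (n+1)`, i.e. onto the sets of nonzero elements of the
order-4 subgroups of the elementary abelian 2-group `({0, …, 2 ^ (n+1) - 1}, ^^^)`. -/
theorem naive_matrix_rows_bijOn (n : ℕ) (hn : 1 ≤ n)
    (A : ℕ+ → ℕ+ → Bool) (hA : IsNaiveMatrix 3 (2 ^ n - 1) A)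
    (d : ℕ) (hd : d = (2 ^ (n + 1) - 1) * (2 ^ n - 1) / 3) :
    Set.BijOn (fun i : ℕ+ => {j : ℕ | ∃ j' : ℕ+, (j' : ℕ) = j ∧ A i j' = true})
      {i : ℕ+ | (i : ℕ) ≤ d}
      {s : Set ℕ | ∃ a b : ℕ, 0 < a ∧ a < b ∧ b < a ^^^ b ∧ a ^^^ b < 2 ^ (n + 1) ∧
        s = {a, b, a ^^^ b}} := by
  have hcard := NaiveAux.card_Lns n
  have hd' : (NaiveAux.Lns (2 ^ (n + 1))).card = d := by omega
  have hrow := NaiveAux.rows n A hA d hd'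
  set e := (NaiveAux.Lns (2 ^ (n + 1))).orderEmbOfFin hd' with he
  have hLn : ∀ q, NaiveAux.IsLn (2 ^ (n + 1)) (e q) := fun q =>
    NaiveAux.mem_Lns.1 (Finset.orderEmbOfFin_mem _ hd' q)
  have hidx : ∀ i : ℕ+, (i : ℕ) ≤ d → ∃ q : Fin d, i = ⟨q + 1, Nat.succ_pos _⟩ := by
    intro i hi
    have h2 := i.pos
    refine ⟨⟨i - 1, by omega⟩, ?_⟩
    apply PNat.eq; simp only [PNat.mk_coe]; omega
  have hset : ∀ q : Fin d, {j : ℕ | ∃ j' : ℕ+, (j' : ℕ) = j ∧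
      A ⟨q + 1, Nat.succ_pos _⟩ j' = true} = {j | NaiveAux.OnLine j (e q)} := by
    intro q
    ext j
    simp only [Set.mem_setOf_eq]
    constructor
    · rintro ⟨j', rfl, h⟩; exact (hrow q j').1 h
    · intro h
      have hj : 0 < j := by
        obtain ⟨_, _, _, _⟩ := hLn q
        unfold NaiveAux.OnLine at h
        omega
      exact ⟨⟨j, hj⟩, rfl, (hrow q ⟨j, hj⟩).2 h⟩
  refine ⟨?_, ?_, ?_⟩
  · intro i hi
    obtain ⟨q, rfl⟩ := hidx i hi
    obtain ⟨h1, h2, h3, h4⟩ := hLn q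
    refine ⟨_, _, h1, h2, h3, h4, ?_⟩
    refine (hset q).trans ?_
    ext x
    simp only [NaiveAux.OnLine, Set.mem_setOf_eq, Set.mem_insert_iff, Set.mem_singleton_iff]
  · intro i hi i' hi' h
    obtain ⟨q, rfl⟩ := hidx i hi
    obtain ⟨q', rfl⟩ := hidx i' hi'
    have h : {j | NaiveAux.OnLine j (e q)} = {j | NaiveAux.OnLine j (e q')} := by
      rw [← hset q, ← hset q']; exact h
    have ha : NaiveAux.OnLine (ofLex (e q)).1 (e q) := Or.inl rfl
    have hb : NaiveAux.OnLine (ofLex (e q)).2 (e q) := Or.inr (Or.inl rfl)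
    have ha' : NaiveAux.OnLine (ofLex (e q)).1 (e q') := (Set.ext_iff.1 h _).1 ha
    have hb' : NaiveAux.OnLine (ofLex (e q)).2 (e q') := (Set.ext_iff.1 h _).1 hb
    have := e.injective (NaiveAux.line_unique (hLn q) (hLn q') (hLn q).2.1 ha hb ha' hb')
    rw [this]
  · rintro s ⟨a, b, h1, h2, h3, h4, rfl⟩
    have hp : NaiveAux.IsLn (2 ^ (n + 1)) (toLex (a, b)) := ⟨h1, h2, h3, h4⟩
    have : toLex (a, b) ∈ Set.range e := by
      rw [he, Finset.range_orderEmbOfFin]; exact NaiveAux.mem_Lns.2 hp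
    obtain ⟨q, hq⟩ := this
    refine ⟨⟨q + 1, Nat.succ_pos _⟩, ?_, ?_⟩
    · exact q.2
    · refine (hset q).trans ?_
      rw [hq]
      ext x
      simp only [NaiveAux.OnLine, Set.mem_setOf_eq, Set.mem_insert_iff, Set.mem_singleton_iff,
        ofLex_toLex]
end

section
/- Let n ≥ 1, k = 3, r = 2^n − 1, d = (2^{n+1} − 1)(2^n − 1)/3, s = 2^{n+1} − 1, and let A be the naive matrix of type (k,r). Then A is periodic with period (d, s): A(i + d, j + s) = A(i, j) for all positive integers i, j. -/
/-- `x` lies on the line spanned by the pair `q`. -/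
def OnLine (q : ℕ × ℕ) (x : ℕ) : Prop := x = q.1 ∨ x = q.2 ∨ x = q.1 ^^^ q.2

instance (q : ℕ × ℕ) (x : ℕ) : Decidable (OnLine q x) := by unfold OnLine; infer_instance

/-- The pairs `(a, b)` with `0 < a < b < a xor b < N`. -/
def lineSet (N : ℕ) : Finset (ℕ × ℕ) :=
  (Finset.range N ×ˢ Finset.range N).filter
    fun q => 0 < q.1 ∧ q.1 < q.2 ∧ q.2 < q.1 ^^^ q.2 ∧ q.1 ^^^ q.2 < N

theorem mem_lineSet {N : ℕ} {q : ℕ × ℕ} :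
    q ∈ lineSet N ↔ 0 < q.1 ∧ q.1 < q.2 ∧ q.2 < q.1 ^^^ q.2 ∧ q.1 ^^^ q.2 < N := by
  simp only [lineSet, Finset.mem_filter, Finset.mem_product, Finset.mem_range]
  constructor
  · exact fun h => h.2
  · intro h
    refine ⟨⟨?_, ?_⟩, h⟩ <;> omega

theorem OnLine.bounds {N : ℕ} {q : ℕ × ℕ} {x : ℕ} (h : OnLine q x) (hq : q ∈ lineSet N) :
    0 < x ∧ x < N ∧ q.1 ≤ x ∧ (x ≠ q.1 → q.2 ≤ x) ∧ x ≤ q.1 ^^^ q.2 := by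
  rw [mem_lineSet] at hq
  unfold OnLine at h
  generalize q.1 ^^^ q.2 = c at *
  omega

theorem OnLine.third {q : ℕ × ℕ} {x y : ℕ} (hx : OnLine q x) (hy : OnLine q y) (hxy : x ≠ y) :
    ∀ z, OnLine q z ↔ (z = x ∨ z = y ∨ z = x ^^^ y) := by
  intro z
  obtain ⟨a, b⟩ := q
  simp only [OnLine] at *
  have e1 : a ^^^ (a ^^^ b) = b := by rw [← Nat.xor_assoc]; simp
  have e2 : b ^^^ (a ^^^ b) = a := by rw [Nat.xor_comm a b, ← Nat.xor_assoc]; simp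
  rcases hx with rfl | rfl | rfl <;> rcases hy with rfl | rfl | rfl <;>
    first
    | exact absurd rfl hxy
    | (simp only [e1, Nat.xor_comm] ; try tauto)
  all_goals
    simp only [Nat.xor_comm] at *
    simp only [e2]
    tauto

theorem line_unique {N : ℕ} {q q' : ℕ × ℕ} (hq : q ∈ lineSet N) (hq' : q' ∈ lineSet N)
    {x y : ℕ} (hxy : x ≠ y) (h1 : OnLine q x) (h2 : OnLine q y) (h3 : OnLine q' x)
    (h4 : OnLine q' y) : q = q' := by
  have hh : ∀ z, OnLine q z ↔ OnLine q' z := fun z =>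
    (h1.third h2 hxy z).trans (h3.third h4 hxy z).symm
  have a1 : OnLine q q'.1 := (hh _).2 (Or.inl rfl)
  have a2 : OnLine q q'.2 := (hh _).2 (Or.inr (Or.inl rfl))
  have b1 : OnLine q' q.1 := (hh _).1 (Or.inl rfl)
  have b2 : OnLine q' q.2 := (hh _).1 (Or.inr (Or.inl rfl))
  have a1 := a1.bounds hq
  have a2 := a2.bounds hq
  have b1 := b1.bounds hq'
  have b2 := b2.bounds hq'
  rw [mem_lineSet] at hq hq'
  ext <;> omega

theorem line_exists {m : ℕ} {x y : ℕ} (hx : 0 < x) (hy : 0 < y) (hxm : x < 2 ^ m)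
    (hym : y < 2 ^ m) (hxy : x ≠ y) :
    ∃ q ∈ lineSet (2 ^ m), OnLine q x ∧ OnLine q y := by
  have hz : x ^^^ y < 2 ^ m := Nat.xor_lt_two_pow hxm hym
  have hz0 : x ^^^ y ≠ 0 := by simpa [Nat.xor_eq_zero_iff] using hxy
  have e1 : x ^^^ (x ^^^ y) = y := by rw [← Nat.xor_assoc]; simp
  have e2 : y ^^^ (x ^^^ y) = x := by rw [Nat.xor_comm x y, ← Nat.xor_assoc]; simp
  have hzx : x ^^^ y ≠ x := fun h => by rw [h] at e1; simp at e1; omega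
  have hzy : x ^^^ y ≠ y := fun h => by rw [h] at e2; simp at e2; omega
  have e3 := Nat.xor_comm x y
  have e4 := Nat.xor_comm x (x ^^^ y)
  have e5 := Nat.xor_comm y (x ^^^ y)
  obtain ⟨z, hz'⟩ : ∃ z, z = x ^^^ y := ⟨_, rfl⟩
  rw [← hz'] at hz hz0 e1 e2 hzx hzy e3 e4 e5
  have : (x < y ∧ y < z) ∨ (x < z ∧ z < y) ∨ (y < x ∧ x < z) ∨ (y < z ∧ z < x) ∨
    (z < x ∧ x < y) ∨ (z < y ∧ y < x) := by omega
  rcases this with h | h | h | h | h | h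
  · refine ⟨(x, y), ?_, ?_⟩
    · rw [mem_lineSet]; simp only; omega
    · simp only [OnLine, true_or, or_true, true_and, and_true] <;> omega
  · refine ⟨(x, z), ?_, ?_⟩
    · rw [mem_lineSet]; simp only; omega
    · simp only [OnLine, true_or, or_true, true_and, and_true] <;> omega
  · refine ⟨(y, x), ?_, ?_⟩
    · rw [mem_lineSet]; simp only; omega
    · simp only [OnLine, true_or, or_true, true_and, and_true] <;> omega
  · refine ⟨(y, z), ?_, ?_⟩
    · rw [mem_lineSet]; simp only; omega
    · simp only [OnLine, true_or, or_true, true_and, and_true] <;> omega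
  · refine ⟨(z, x), ?_, ?_⟩
    · rw [mem_lineSet]; simp only; omega
    · simp only [OnLine, true_or, or_true, true_and, and_true] <;> omega
  · refine ⟨(z, y), ?_, ?_⟩
    · rw [mem_lineSet]; simp only; omega
    · simp only [OnLine, true_or, or_true, true_and, and_true] <;> omega

theorem line_points {N : ℕ} {q : ℕ × ℕ} (hq : q ∈ lineSet N) :
    ((Finset.Ico 1 N).filter fun y => OnLine q y) = {q.1, q.2, q.1 ^^^ q.2} := by
  ext y
  simp only [Finset.mem_filter, Finset.mem_Ico, Finset.mem_insert, Finset.mem_singleton]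
  constructor
  · exact fun h => h.2
  · intro h
    have := OnLine.bounds (x := y) h hq
    exact ⟨by omega, h⟩

theorem line_card {N : ℕ} {q : ℕ × ℕ} (hq : q ∈ lineSet N) :
    ((Finset.Ico 1 N).filter fun y => OnLine q y).card = 3 := by
  rw [line_points hq, Finset.card_eq_three]
  rw [mem_lineSet] at hq
  exact ⟨_, _, _, by omega, by omega, by omega, rfl⟩

theorem deg_eq {n x : ℕ} (hx : 0 < x) (hxm : x < 2 ^ (n + 1)) :
    ((lineSet (2 ^ (n + 1))).filter fun q => OnLine q x).card = 2 ^ n - 1 := by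
  classical
  have key := Finset.card_mul_eq_card_mul (s := (Finset.Ico 1 (2 ^ (n + 1))).erase x)
    (t := (lineSet (2 ^ (n + 1))).filter fun q => OnLine q x) (m := 1) (n := 2)
    (fun y q => OnLine q y) ?_ ?_
  · rw [Finset.card_erase_of_mem (by simp; omega), Nat.card_Ico] at key
    rw [pow_succ] at *
    omega
  · intro y hy
    simp only [Finset.mem_erase, Finset.mem_Ico] at hy
    obtain ⟨q, hq, h1, h2⟩ := line_exists hx (by omega) hxm hy.2.2 (Ne.symm hy.1)
    rw [Finset.card_eq_one]
    refine ⟨q, ?_⟩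
    ext q'
    simp only [Finset.mem_bipartiteAbove, Finset.mem_filter, Finset.mem_singleton]
    constructor
    · rintro ⟨⟨h3, h4⟩, h5⟩
      exact line_unique h3 hq hy.1 h5 h4 h2 h1
    · rintro rfl
      exact ⟨⟨hq, h1⟩, h2⟩
  · intro q hq
    rw [Finset.mem_filter] at hq
    have : Finset.bipartiteBelow (fun y q => OnLine q y)
        ((Finset.Ico 1 (2 ^ (n + 1))).erase x) q =
        ((Finset.Ico 1 (2 ^ (n + 1))).filter fun y => OnLine q y).erase x := by
      ext y
      simp only [Finset.mem_bipartiteBelow, Finset.mem_filter, Finset.mem_erase]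
      tauto
    rw [this, Finset.card_erase_of_mem, line_card hq.1]
    simp only [Finset.mem_filter, Finset.mem_Ico]
    exact ⟨by omega, hq.2⟩

theorem lineSet_card (n : ℕ) :
    (lineSet (2 ^ (n + 1))).card = (2 ^ (n + 1) - 1) * (2 ^ n - 1) / 3 := by
  classical
  have key := Finset.card_mul_eq_card_mul (s := Finset.Ico 1 (2 ^ (n + 1)))
    (t := lineSet (2 ^ (n + 1))) (m := 2 ^ n - 1) (n := 3)
    (fun y q => OnLine q y) ?_ ?_
  · rw [Nat.card_Ico] at key
    rw [key]; simp
  · intro y hy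
    rw [Finset.mem_Ico] at hy
    exact deg_eq (by omega) hy.2
  · intro q hq
    exact line_card hq

/-- Lexicographic enumeration of the lines. -/
theorem enum_exists (N : ℕ) : ∃ f : ℕ → ℕ × ℕ,
    (∀ i < (lineSet N).card, f i ∈ lineSet N) ∧
    (∀ q ∈ lineSet N, ∃ i < (lineSet N).card, f i = q) ∧
    (∀ i < (lineSet N).card, ∀ j < (lineSet N).card, f i = f j → i = j) ∧
    (∀ i < (lineSet N).card, ∀ j < (lineSet N).card,
      ((f i).1 < (f j).1 ∨ ((f i).1 = (f j).1 ∧ (f i).2 < (f j).2)) → i < j) := by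
  classical
  let S : Finset (ℕ ×ₗ ℕ) := (lineSet N).map toLex.toEmbedding
  have hS : S.card = (lineSet N).card := Finset.card_map _
  let e := S.orderEmbOfFin hS
  have hmem : ∀ i, ofLex (e i) ∈ lineSet N := by
    intro i
    have := S.orderEmbOfFin_mem hS i
    rw [Finset.mem_map] at this
    obtain ⟨a, ha, hb⟩ := this
    change ofLex (S.orderEmbOfFin hS i) ∈ _
    rw [← hb]; exact ha
  refine ⟨fun i => if h : i < (lineSet N).card then ofLex (e ⟨i, h⟩) else 0, ?_, ?_, ?_, ?_⟩
  · intro i hi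
    simp only [hi, dif_pos]; exact hmem _
  · intro q hq
    have : toLex q ∈ Set.range e := by
      rw [Finset.range_orderEmbOfFin]
      simpa [S] using hq
    obtain ⟨i, hi⟩ := this
    refine ⟨i, i.2, ?_⟩
    simp only [i.2, dif_pos, Fin.eta, hi]; rfl
  · intro i hi j hj h
    simp only [hi, hj, dif_pos] at h
    have := e.injective (ofLex.injective h)
    simpa using this
  · intro i hi j hj h
    simp only [hi, hj, dif_pos] at h
    have : e ⟨i, hi⟩ < e ⟨j, hj⟩ := by
      rw [Prod.Lex.lt_iff]; exact h
    simpa using this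

open Classical in
/-- The naive rule on `ℕ × ℕ` (rows indexed from `0`, columns from `1`). -/
def NatNaive (r : ℕ) (P : ℕ → ℕ → Prop) : Prop :=
  ∀ i j : ℕ, P i j ↔ 0 < j ∧
    ¬ ((∃ i' < i, ∃ j' < j, P i j' ∧ P i' j ∧ P i' j') ∨
      3 ≤ ((Finset.range j).filter fun j' => P i j').card ∨
      r ≤ ((Finset.range i).filter fun i' => P i' j).card)

theorem NatNaive.unique {r : ℕ} {P Q : ℕ → ℕ → Prop} (hP : NatNaive r P) (hQ : NatNaive r Q) :
    ∀ i j, P i j ↔ Q i j := by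
  classical
  intro i
  induction i using Nat.strong_induction_on with
  | _ i ihi =>
    intro j
    induction j using Nat.strong_induction_on with
    | _ j ihj =>
      rw [hP i j, hQ i j]
      have h1 : ((Finset.range j).filter fun j' => P i j') =
          (Finset.range j).filter fun j' => Q i j' :=
        Finset.filter_congr fun x hx => ihj x (Finset.mem_range.1 hx)
      have h2 : ((Finset.range i).filter fun i' => P i' j) =
          (Finset.range i).filter fun i' => Q i' j :=
        Finset.filter_congr fun x hx => ihi x (Finset.mem_range.1 hx) j
      have h3 : (∃ i' < i, ∃ j' < j, P i j' ∧ P i' j ∧ P i' j') ↔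
          (∃ i' < i, ∃ j' < j, Q i j' ∧ Q i' j ∧ Q i' j') := by
        constructor
        · rintro ⟨i', hi, j', hj, a, b, c⟩
          exact ⟨i', hi, j', hj, (ihj _ hj).1 a, (ihi _ hi _).1 b, (ihi _ hi _).1 c⟩
        · rintro ⟨i', hi, j', hj, a, b, c⟩
          exact ⟨i', hi, j', hj, (ihj _ hj).2 a, (ihi _ hi _).2 b, (ihi _ hi _).2 c⟩
      rw [h1, h2, h3]

/-- Number of lines through `x` in the enumeration. -/
theorem enum_deg {n x : ℕ} (hx : 0 < x) (hxm : x < 2 ^ (n + 1)) {f : ℕ → ℕ × ℕ}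
    (h1 : ∀ i < (lineSet (2 ^ (n + 1))).card, f i ∈ lineSet (2 ^ (n + 1)))
    (h2 : ∀ q ∈ lineSet (2 ^ (n + 1)), ∃ i < (lineSet (2 ^ (n + 1))).card, f i = q)
    (h3 : ∀ i < (lineSet (2 ^ (n + 1))).card, ∀ j < (lineSet (2 ^ (n + 1))).card,
      f i = f j → i = j) :
    ((Finset.range (lineSet (2 ^ (n + 1))).card).filter fun i => OnLine (f i) x).card
      = 2 ^ n - 1 := by
  rw [← deg_eq hx hxm]
  refine Finset.card_bij (fun i _ => f i) ?_ ?_ ?_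
  · intro i hi
    simp only [Finset.mem_filter, Finset.mem_range] at hi ⊢
    exact ⟨h1 i hi.1, hi.2⟩
  · intro i hi j hj h
    simp only [Finset.mem_filter, Finset.mem_range] at hi hj
    exact h3 i hi.1 j hj.1 h
  · intro q hq
    simp only [Finset.mem_filter] at hq
    obtain ⟨i, hi, rfl⟩ := h2 q hq.1
    exact ⟨i, by simp [hi, hq.2], rfl⟩

theorem rows_are_lines {n : ℕ} {P : ℕ → ℕ → Prop} (hP : NatNaive (2 ^ n - 1) P)
    {f : ℕ → ℕ × ℕ}
    (h1 : ∀ i < (lineSet (2 ^ (n + 1))).card, f i ∈ lineSet (2 ^ (n + 1)))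
    (h2 : ∀ q ∈ lineSet (2 ^ (n + 1)), ∃ i < (lineSet (2 ^ (n + 1))).card, f i = q)
    (h3 : ∀ i < (lineSet (2 ^ (n + 1))).card, ∀ j < (lineSet (2 ^ (n + 1))).card,
      f i = f j → i = j)
    (h4 : ∀ i < (lineSet (2 ^ (n + 1))).card, ∀ j < (lineSet (2 ^ (n + 1))).card,
      ((f i).1 < (f j).1 ∨ ((f i).1 = (f j).1 ∧ (f i).2 < (f j).2)) → i < j) :
    ∀ i < (lineSet (2 ^ (n + 1))).card, ∀ j, P i j ↔ OnLine (f i) j := by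
  classical
  intro i
  induction i using Nat.strong_induction_on with
  | _ i ihi =>
    intro hi j
    induction j using Nat.strong_induction_on with
    | _ j ihj =>
      have hfi := h1 i hi
      have hfi' := mem_lineSet.1 hfi
      have e1 : ((Finset.range j).filter fun j' => P i j') =
          (Finset.range j).filter fun j' => OnLine (f i) j' :=
        Finset.filter_congr fun x hx => ihj x (Finset.mem_range.1 hx)
      have e2 : ((Finset.range i).filter fun i' => P i' j) =
          (Finset.range i).filter fun i' => OnLine (f i') j :=
        Finset.filter_congr fun x hx => ihi x (Finset.mem_range.1 hx)
          ((Finset.mem_range.1 hx).trans hi) j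
      have oa : OnLine (f i) (f i).1 := Or.inl rfl
      have ob : OnLine (f i) (f i).2 := Or.inr (Or.inl rfl)
      have oc : OnLine (f i) ((f i).1 ^^^ (f i).2) := Or.inr (Or.inr rfl)
      rw [hP i j, e1, e2]
      constructor
      · rintro ⟨hj0, hno⟩
        by_contra hj
        apply hno
        have na : j ≠ (f i).1 := fun h => hj (h ▸ oa)
        have nb : j ≠ (f i).2 := fun h => hj (h ▸ ob)
        have nc : j ≠ (f i).1 ^^^ (f i).2 := fun h => hj (h ▸ oc)
        -- a smaller line through `j` and an earlier point gives condition (i)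
        have wit : ∀ q ∈ lineSet (2 ^ (n + 1)), ∀ j' < j, OnLine (f i) j' → OnLine q j →
            OnLine q j' → (q.1 < (f i).1 ∨ (q.1 = (f i).1 ∧ q.2 < (f i).2)) →
            (∃ i' < i, ∃ j' < j, P i j' ∧ P i' j ∧ P i' j') := by
          intro q hq j' hj' o1 o2 o3 hlt
          obtain ⟨i', hi', rfl⟩ := h2 q hq
          have hii := h4 i' hi' i hi hlt
          exact ⟨i', hii, j', hj', (ihj _ hj').2 o1, (ihi _ hii hi' _).2 o2,
            (ihi _ hii hi' _).2 o3⟩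
        rcases lt_or_ge ((f i).1 ^^^ (f i).2) j with hjc | hjc
        · right; left
          have : ({(f i).1, (f i).2, (f i).1 ^^^ (f i).2} : Finset ℕ) ⊆
              (Finset.range j).filter fun j' => OnLine (f i) j' := by
            intro y hy
            simp only [Finset.mem_insert, Finset.mem_singleton] at hy
            simp only [Finset.mem_filter, Finset.mem_range]
            exact ⟨by omega, hy⟩
          refine le_trans ?_ (Finset.card_le_card this)
          rw [← line_points hfi, line_card hfi]
        have hjN : j < 2 ^ (n + 1) := by omega
        rcases lt_or_ge j (f i).1 with hja | hja
        · right; right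
          rw [← enum_deg hj0 hjN h1 h2 h3]
          apply Finset.card_le_card
          intro i' hi'
          simp only [Finset.mem_filter, Finset.mem_range] at hi' ⊢
          refine ⟨h4 i' hi'.1 i hi (Or.inl ?_), hi'.2⟩
          have := hi'.2.bounds (h1 i' hi'.1)
          omega
        left
        rcases lt_or_ge j (f i).2 with hjb | hjb
        · obtain ⟨q, hq, o1, o2⟩ := line_exists (x := (f i).1) (y := j) hfi'.1 hj0 (by omega) hjN
            (by omega)
          refine wit q hq (f i).1 (by omega) oa o2 o1 ?_
          have b1 := o1.bounds hq
          have b2 := o2.bounds hq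
          omega
        · have hlt : j < (f i).1 ^^^ (f i).2 := by omega
          rcases Nat.lt_xor_cases hlt with h | h
          · obtain ⟨q, hq, o1, o2⟩ := line_exists (x := j) (y := (f i).2) hj0 (by omega) hjN
              (by omega) nb
            refine wit q hq (f i).2 (by omega) ob o1 o2 ?_
            have o3 : OnLine q (j ^^^ (f i).2) := (o1.third o2 nb _).2 (Or.inr (Or.inr rfl))
            have b3 := o3.bounds hq
            omega
          · obtain ⟨q, hq, o1, o2⟩ := line_exists (x := j) (y := (f i).1) hj0 (by omega) hjN
              (by omega) na
            refine wit q hq (f i).1 (by omega) oa o1 o2 ?_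
            have o3 : OnLine q (j ^^^ (f i).1) := (o1.third o2 na _).2 (Or.inr (Or.inr rfl))
            have b2 := o2.bounds hq
            have b3 := o3.bounds hq
            have hne : j ^^^ (f i).1 ≠ (f i).1 := by
              intro h
              have : (j ^^^ (f i).1) ^^^ (f i).1 = j := by rw [Nat.xor_assoc]; simp
              rw [h] at this; simp at this; omega
            omega
      · intro hj
        have bj := hj.bounds hfi
        refine ⟨bj.1, ?_⟩
        rintro (⟨i', hi', j', hj', a, b, c⟩ | h | h)
        · have hi'd := hi'.trans hi
          have := line_unique (h1 i' hi'd) hfi (x := j') (y := j) (by omega)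
            ((ihi _ hi' hi'd _).1 c) ((ihi _ hi' hi'd _).1 b) ((ihj _ hj').1 a) hj
          have := h3 _ hi'd _ hi this
          omega
        · have hlt : ((Finset.range j).filter fun j' => OnLine (f i) j').card <
              ((Finset.Ico 1 (2 ^ (n + 1))).filter fun y => OnLine (f i) y).card := by
            apply Finset.card_lt_card
            rw [Finset.ssubset_iff_of_subset]
            · refine ⟨j, ?_, by simp⟩
              simp only [Finset.mem_filter, Finset.mem_Ico]
              exact ⟨by omega, hj⟩
            · intro y hy
              simp only [Finset.mem_filter, Finset.mem_Ico] at hy ⊢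
              have := hy.2.bounds hfi
              exact ⟨by omega, hy.2⟩
          rw [line_card hfi] at hlt
          omega
        · have hlt : ((Finset.range i).filter fun i' => OnLine (f i') j).card <
              ((Finset.range (lineSet (2 ^ (n + 1))).card).filter
                fun i' => OnLine (f i') j).card := by
            apply Finset.card_lt_card
            rw [Finset.ssubset_iff_of_subset]
            · refine ⟨i, ?_, by simp⟩
              simp only [Finset.mem_filter, Finset.mem_range]
              exact ⟨hi, hj⟩
            · intro y hy
              simp only [Finset.mem_filter, Finset.mem_range] at hy ⊢
              exact ⟨by omega, hy.2⟩
          rw [enum_deg bj.1 bj.2.1 h1 h2 h3] at hlt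
          omega

theorem NatNaive.periodic {n : ℕ} {P : ℕ → ℕ → Prop} (hP : NatNaive (2 ^ n - 1) P) (i j : ℕ)
    (hj : 0 < j) :
    P (i + (lineSet (2 ^ (n + 1))).card) (j + (2 ^ (n + 1) - 1)) ↔ P i j := by
  classical
  obtain ⟨f, h1, h2, h3, h4⟩ := enum_exists (2 ^ (n + 1))
  have hrow := rows_are_lines hP h1 h2 h3 h4
  have hdeg := fun x hx hxm => enum_deg (n := n) (x := x) hx hxm h1 h2 h3
  generalize (lineSet (2 ^ (n + 1))).card = d at *
  have hN : 0 < 2 ^ (n + 1) := by positivity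
  obtain ⟨s, hs⟩ : ∃ s, 2 ^ (n + 1) = s + 1 := ⟨2 ^ (n + 1) - 1, by omega⟩
  rw [hs] at h1 hdeg ⊢
  simp only [Nat.add_sub_cancel]
  have low : ∀ i j, i < d → P i j → 0 < j ∧ j ≤ s := by
    intro i j hi h
    have := ((hrow i hi j).1 h).bounds (h1 i hi)
    omega
  have high : ∀ i j, P (i + d) j → s < j := by
    intro i j h
    have h' := (hP _ _).1 h
    by_contra hjs
    apply h'.2
    right; right
    rw [← hdeg j h'.1 (by omega)]
    apply Finset.card_le_card
    intro y hy
    simp only [Finset.mem_filter, Finset.mem_range] at hy ⊢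
    exact ⟨by omega, (hrow y hy.1 j).2 hy.2⟩
  have hQ : NatNaive (2 ^ n - 1) (fun i j => 0 < j ∧ P (i + d) (j + s)) := by
    intro i j
    refine and_congr_right fun hj0 => ?_
    rw [hP (i + d) (j + s)]
    have c1 : ((Finset.range (j + s)).filter fun j' => P (i + d) j').card =
        ((Finset.range j).filter fun j' => 0 < j' ∧ P (i + d) (j' + s)).card := by
      symm
      refine Finset.card_bij (fun x _ => x + s) ?_ ?_ ?_
      · intro a ha
        simp only [Finset.mem_filter, Finset.mem_range] at ha ⊢
        exact ⟨by omega, ha.2.2⟩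
      · intro a _ b _ h
        simpa using h
      · intro b hb
        simp only [Finset.mem_filter, Finset.mem_range] at hb
        have := high _ _ hb.2
        refine ⟨b - s, ?_, by omega⟩
        simp only [Finset.mem_filter, Finset.mem_range]
        rw [Nat.sub_add_cancel this.le]
        exact ⟨by omega, by omega, hb.2⟩
    have c2 : ((Finset.range (i + d)).filter fun i' => P i' (j + s)).card =
        ((Finset.range i).filter fun i' => 0 < j ∧ P (i' + d) (j + s)).card := by
      symm
      refine Finset.card_bij (fun x _ => x + d) ?_ ?_ ?_
      · intro a ha
        simp only [Finset.mem_filter, Finset.mem_range] at ha ⊢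
        exact ⟨by omega, ha.2.2⟩
      · intro a _ b _ h
        simpa using h
      · intro b hb
        simp only [Finset.mem_filter, Finset.mem_range] at hb
        have hbd : d ≤ b := by
          by_contra hbd
          have := low _ _ (not_le.1 hbd) hb.2
          omega
        refine ⟨b - d, ?_, by omega⟩
        simp only [Finset.mem_filter, Finset.mem_range]
        rw [Nat.sub_add_cancel hbd]
        exact ⟨by omega, by omega, hb.2⟩
    have c3 : (∃ i' < i + d, ∃ j' < j + s, P (i + d) j' ∧ P i' (j + s) ∧ P i' j') ↔
        (∃ i' < i, ∃ j' < j, (0 < j' ∧ P (i + d) (j' + s)) ∧ (0 < j ∧ P (i' + d) (j + s)) ∧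
          (0 < j' ∧ P (i' + d) (j' + s))) := by
      constructor
      · rintro ⟨i', hi', j', hj', a, b, c⟩
        have hbd : d ≤ i' := by
          by_contra hbd
          have := low _ _ (not_le.1 hbd) b
          omega
        have hsj := high _ _ a
        obtain ⟨u, rfl⟩ : ∃ u, i' = u + d := ⟨i' - d, by omega⟩
        obtain ⟨v, rfl⟩ : ∃ v, j' = v + s := ⟨j' - s, by omega⟩
        exact ⟨u, by omega, v, by omega, ⟨by omega, a⟩, ⟨hj0, b⟩, by omega, c⟩
      · rintro ⟨i', hi', j', hj', a, b, c⟩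
        exact ⟨i' + d, by omega, j' + s, by omega, a.2, b.2, c.2⟩
    rw [c1, c2, c3]
    have hjs : 0 < j + s := by omega
    simp only [hjs, true_and]
  have := hQ.unique hP i j
  simp only [hj, true_and] at this
  exact this

theorem IsNaiveMatrix.natNaive {r : ℕ} {A : ℕ+ → ℕ+ → Bool} (hA : IsNaiveMatrix 3 r A) :
    NatNaive r (fun i j => 0 < j ∧ A i.succPNat j.toPNat' = true) := by
  classical
  intro i j
  refine and_congr_right fun hj0 => ?_
  rw [hA]
  have key : ∀ m : ℕ+, ((m : ℕ).toPNat') = m := fun m => PNat.coe_toPNat' m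
  have keyj : ((j.toPNat' : ℕ+) : ℕ) = j := by simp [Nat.toPNat'_coe, hj0]
  have hpos : ∀ {m : ℕ}, 0 < m → ((m.toPNat' : ℕ+) : ℕ) = m := fun h => by simp [Nat.toPNat'_coe, h]
  have c1 : ((Finset.Ico 1 j.toPNat').filter fun j' => A i.succPNat j' = true).card =
      ((Finset.range j).filter fun j' => 0 < j' ∧ A i.succPNat j'.toPNat' = true).card := by
    refine Finset.card_bij (fun x _ => (x : ℕ)) ?_ ?_ ?_
    · intro a ha
      simp only [Finset.mem_filter, Finset.mem_range, Finset.mem_Ico, ← PNat.coe_lt_coe, keyj,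
        key] at ha ⊢
      exact ⟨ha.1.2, a.pos, ha.2⟩
    · intro a _ b _ h
      exact PNat.coe_injective h
    · intro b hb
      simp only [Finset.mem_filter, Finset.mem_range] at hb
      refine ⟨b.toPNat', ?_, hpos hb.2.1⟩
      simp only [Finset.mem_filter, Finset.mem_Ico, ← PNat.coe_lt_coe, keyj, hpos hb.2.1]
      exact ⟨⟨one_le, hb.1⟩, hb.2.2⟩
  have c2 : ((Finset.Ico 1 i.succPNat).filter fun i' => A i' j.toPNat' = true).card =
      ((Finset.range i).filter fun i' => 0 < j ∧ A i'.succPNat j.toPNat' = true).card := by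
    symm
    refine Finset.card_bij (fun x _ => x.succPNat) ?_ ?_ ?_
    · intro a ha
      simp only [Finset.mem_filter, Finset.mem_range, Finset.mem_Ico, ← PNat.coe_lt_coe,
        Nat.succPNat_coe] at ha ⊢
      exact ⟨⟨one_le, by omega⟩, ha.2.2⟩
    · intro a _ b _ h
      exact Nat.succPNat_injective h
    · intro b hb
      simp only [Finset.mem_filter, Finset.mem_Ico, ← PNat.coe_lt_coe, Nat.succPNat_coe] at hb
      refine ⟨b.natPred, ?_, PNat.succPNat_natPred b⟩
      simp only [Finset.mem_filter, Finset.mem_range, PNat.succPNat_natPred]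
      have := PNat.natPred_add_one b
      exact ⟨by omega, hj0, hb.2⟩
  have c3 : (∃ i' < i.succPNat, ∃ j' < j.toPNat', A i.succPNat j' = true ∧
        A i' j.toPNat' = true ∧ A i' j' = true) ↔
      (∃ i' < i, ∃ j' < j, (0 < j' ∧ A i.succPNat j'.toPNat' = true) ∧
        (0 < j ∧ A i'.succPNat j.toPNat' = true) ∧
        (0 < j' ∧ A i'.succPNat j'.toPNat' = true)) := by
    constructor
    · rintro ⟨i', hi', j', hj', a, b, c⟩
      rw [← PNat.coe_lt_coe, Nat.succPNat_coe] at hi'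
      rw [← PNat.coe_lt_coe, keyj] at hj'
      have := PNat.natPred_add_one i'
      refine ⟨i'.natPred, by omega, j', hj', ?_⟩
      simp only [key, PNat.succPNat_natPred]
      exact ⟨⟨j'.pos, a⟩, ⟨hj0, b⟩, j'.pos, c⟩
    · rintro ⟨i', hi', j', hj', a, b, c⟩
      refine ⟨i'.succPNat, ?_, j'.toPNat', ?_, a.2, b.2, c.2⟩
      · rw [← PNat.coe_lt_coe, Nat.succPNat_coe, Nat.succPNat_coe]; omega
      · rw [← PNat.coe_lt_coe, keyj, hpos a.1]; exact hj'
  rw [c1, c2, c3]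
  convert Iff.rfl

/-- For `k = 3`, `r = 2 ^ n - 1` (`n ≥ 1`), `d = (2 ^ (n+1) - 1) * (2 ^ n - 1) / 3` and
`s = 2 ^ (n+1) - 1`, the naive matrix `A` of type `(k, r)` is periodic with period
`(d, s)`: `A (i + d) (j + s) = A i j` for all positive integers `i`, `j`. -/
theorem naive_matrix_periodic (n : ℕ) (hn : 1 ≤ n)
    (A : ℕ+ → ℕ+ → Bool) (hA : IsNaiveMatrix 3 (2 ^ n - 1) A)
    (d s : ℕ+) (hd : (d : ℕ) = (2 ^ (n + 1) - 1) * (2 ^ n - 1) / 3)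
    (hs : (s : ℕ) = 2 ^ (n + 1) - 1) :
    ∀ i j : ℕ+, A (i + d) (j + s) = A i j := by
  intro i j
  have h := hA.natNaive.periodic i.natPred j j.pos
  rw [lineSet_card, ← hd, ← hs] at h
  have e1 : (i.natPred + (d : ℕ)).succPNat = i + d := by
    apply PNat.coe_injective
    have := PNat.natPred_add_one i
    rw [Nat.succPNat_coe, PNat.add_coe]; omega
  have e2 : ((j : ℕ) + (s : ℕ)).toPNat' = j + s := by
    rw [← PNat.add_coe, PNat.coe_toPNat']
  have hp : 0 < (j : ℕ) + s := by have := j.pos; omega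
  rw [e1, e2, PNat.succPNat_natPred, PNat.coe_toPNat'] at h
  simp only [hp, j.pos, true_and] at h
  exact Bool.eq_iff_iff.2 h
end
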